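/- arXiv:math/0307145 — 2 statements merged into one kernel-verified Lean document; each statement's English description precedes it below -/
import Mathlib

section
/- Let P=(A,C) be a measuring α-pairing with A unital, M a right C-comodule and N a left C-comodule. Regard M⊗_R N as a left module over the enveloping algebra A^e = A⊗_R A^{op} via (a⊗b)·(m⊗n) = a·m⊗n·b, where a·m = Σ m_{<0>}⟨a,m_{<1>}⟩ and n·b = Σ ⟨b,n_{<-1>}⟩n_{<0>}, and regard A as a left A^e-module via (a⊗b)·x = axb. Then γ_{M,N}: M□_C N → Hom_{A^e}(A, M⊗_R N), Σ mᵢ⊗nᵢ ↦ (a ↦ Σ a·mᵢ⊗nᵢ), is an R-module isomorphism with inverse f ↦ f(1_A), and γ_{M,N} is natural in M and N. -/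
open TensorProduct

universe u

/-- The canonical map `α^P_M : M ⊗ C → Hom(A, M)` associated to an `R`-pairing
`β : A → C → R`, sending `Σ mᵢ ⊗ cᵢ` to `a ↦ Σ ⟨a, cᵢ⟩ • mᵢ`. -/
noncomputable def alphaMap (R : Type u) [CommRing R]
    {A : Type u} [AddCommGroup A] [Module R A]
    {C : Type u} [AddCommGroup C] [Module R C]
    (β : A →ₗ[R] C →ₗ[R] R)
    (M : Type u) [AddCommGroup M] [Module R M] :
    (M ⊗[R] C) →ₗ[R] (A →ₗ[R] M) :=
  (dualTensorHom R A M) ∘ₗ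
    (TensorProduct.comm R M (Module.Dual R A)).toLinearMap ∘ₗ
    (TensorProduct.map LinearMap.id β.flip)

/-- `(A, C)` is a measuring pairing: `κ_P : A → C*` is multiplicative into the
convolution algebra `C*`. -/
def IsMeasuring (R : Type u) [CommRing R]
    {A : Type u} [NonUnitalRing A] [Module R A]
    {C : Type u} [AddCommGroup C] [Module R C] [Coalgebra R C]
    (β : A →ₗ[R] C →ₗ[R] R) : Prop :=
  ∀ a b : A,
    β (a * b) =
      (LinearMap.mul' R R) ∘ₗ (TensorProduct.map (β a) (β b)) ∘ₗ
        (Coalgebra.comul (R := R) (A := C))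

/-- The rational submodule `Rat^C(M)` of a module with `A`-action `σ`. -/
noncomputable def ratSubmodule (R : Type u) [CommRing R]
    {A : Type u} [AddCommGroup A] [Module R A]
    {C : Type u} [AddCommGroup C] [Module R C]
    (β : A →ₗ[R] C →ₗ[R] R)
    {M : Type u} [AddCommGroup M] [Module R M]
    (σ : A →ₗ[R] M →ₗ[R] M) : Submodule R M :=
  (LinearMap.range (alphaMap R β M)).comap σ.flip

/-- The `A`-action induced on a right `C`-comodule: `a • m = Σ m₍₀₎⟨a, m₍₁₎⟩`. -/
noncomputable def inducedAction (R : Type u) [CommRing R]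
    {A : Type u} [AddCommGroup A] [Module R A]
    {C : Type u} [AddCommGroup C] [Module R C]
    (β : A →ₗ[R] C →ₗ[R] R)
    {M : Type u} [AddCommGroup M] [Module R M]
    (ϱ : M →ₗ[R] M ⊗[R] C) : A →ₗ[R] M →ₗ[R] M :=
  ((alphaMap R β M) ∘ₗ ϱ).flip

/-- `ϱ : M → M ⊗ C` is a (coassociative, counital) right `C`-comodule structure. -/
def IsRightComodule (R : Type u) [CommRing R]
    {C : Type u} [AddCommGroup C] [Module R C] [Coalgebra R C]
    {M : Type u} [AddCommGroup M] [Module R M]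
    (ϱ : M →ₗ[R] M ⊗[R] C) : Prop :=
  ((TensorProduct.assoc R M C C).toLinearMap ∘ₗ (TensorProduct.map ϱ LinearMap.id) ∘ₗ ϱ
      = (TensorProduct.map LinearMap.id (Coalgebra.comul (R := R))) ∘ₗ ϱ)
  ∧ ∀ m : M,
      (TensorProduct.rid R M)
        ((TensorProduct.map LinearMap.id (Coalgebra.counit (R := R))) (ϱ m)) = m

/-- `ϱ : N → C ⊗ N` is a (coassociative, counital) left `C`-comodule structure. -/
def IsLeftComodule (R : Type u) [CommRing R]
    {C : Type u} [AddCommGroup C] [Module R C] [Coalgebra R C]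
    {N : Type u} [AddCommGroup N] [Module R N]
    (ϱ : N →ₗ[R] C ⊗[R] N) : Prop :=
  ((TensorProduct.assoc R C C N).symm.toLinearMap ∘ₗ (TensorProduct.map LinearMap.id ϱ) ∘ₗ ϱ
      = (TensorProduct.map (Coalgebra.comul (R := R)) LinearMap.id) ∘ₗ ϱ)
  ∧ ∀ n : N,
      (TensorProduct.lid R N)
        ((TensorProduct.map (Coalgebra.counit (R := R)) LinearMap.id) (ϱ n)) = n

/-- The cotensor product `M □_C N` as a submodule of `M ⊗ N`. -/
noncomputable def cotensor (R : Type u) [CommRing R]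
    {C : Type u} [AddCommGroup C] [Module R C]
    {M : Type u} [AddCommGroup M] [Module R M]
    {N : Type u} [AddCommGroup N] [Module R N]
    (ϱM : M →ₗ[R] M ⊗[R] C) (ϱN : N →ₗ[R] C ⊗[R] N) : Submodule R (M ⊗[R] N) :=
  LinearMap.ker
    ((TensorProduct.assoc R M C N).toLinearMap ∘ₗ (TensorProduct.map ϱM LinearMap.id)
      - (TensorProduct.map LinearMap.id ϱN))

/-- The right `A`-action induced on a left `C`-comodule: `n • a = Σ ⟨a, n₍₋₁₎⟩ n₍₀₎`. -/
noncomputable def rAct (R : Type u) [CommRing R]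
    {A : Type u} [AddCommGroup A] [Module R A]
    {C : Type u} [AddCommGroup C] [Module R C]
    {N : Type u} [AddCommGroup N] [Module R N]
    (β : A →ₗ[R] C →ₗ[R] R) (ϱ : N →ₗ[R] C ⊗[R] N) (a : A) : N →ₗ[R] N :=
  (TensorProduct.lid R N).toLinearMap ∘ₗ (TensorProduct.map (β a) LinearMap.id) ∘ₗ ϱ

/-- `Hom_{A-}(B, N)`: the `A`-linear maps `B → N`, where `B` is an `A`-module via `ξ`. -/
noncomputable def homA (R : Type u) [CommRing R]
    {A B N : Type u} [Ring A] [Algebra R A] [Ring B] [Algebra R B]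
    [AddCommGroup N] [Module R N]
    (ξ : A →ₐ[R] B) (σN : A →ₗ[R] N →ₗ[R] N) : Submodule R (B →ₗ[R] N) where
  carrier := {f | ∀ (a : A) (b : B), f (ξ a * b) = σN a (f b)}
  zero_mem' := by intro a b; simp
  add_mem' := by intro f g hf hg a b; simp [hf a b, hg a b]
  smul_mem' := by intro r f hf a b; simp [hf a b]

/-- Evaluation at `1_B` as a linear map on a submodule of `Hom_R(B, N)`. -/
noncomputable def evalAtOne {R B N : Type u} [CommRing R] [Ring B] [Algebra R B]
    [AddCommGroup N] [Module R N] (Hsub : Submodule R (B →ₗ[R] N)) : ↥Hsub →ₗ[R] N where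
  toFun f := (f : B →ₗ[R] N) 1
  map_add' f g := by simp
  map_smul' r f := by simp

section Helpers

variable {R A C M N : Type u} [CommRing R] [AddCommGroup C] [Module R C]
  [AddCommGroup M] [Module R M] [AddCommGroup N] [Module R N]

section Pairing

variable [AddCommGroup A] [Module R A] (β : A →ₗ[R] C →ₗ[R] R)

lemma alphaMap_tmul (m : M) (c : C) (a : A) :
    alphaMap R β M (m ⊗ₜ c) a = β a c • m := by
  simp [alphaMap]

lemma alphaMap_apply_eq_rid (t : M ⊗[R] C) (a : A) :
    alphaMap R β M t a = TensorProduct.rid R M (TensorProduct.map LinearMap.id (β a) t) := by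
  induction t with
  | zero => simp
  | add s t hs ht => simp only [map_add, LinearMap.add_apply, hs, ht]
  | tmul m c => simp [alphaMap_tmul]

lemma inducedAction_apply (ϱ : M →ₗ[R] M ⊗[R] C) (a : A) (m : M) :
    inducedAction R β ϱ a m = alphaMap R β M (ϱ m) a := rfl

lemma alphaMap_map (g : M →ₗ[R] N) (t : M ⊗[R] C) (a : A) :
    alphaMap R β N (TensorProduct.map g LinearMap.id t) a = g (alphaMap R β M t a) := by
  induction t with
  | zero => simp
  | add s t hs ht => simp only [map_add, LinearMap.add_apply, hs, ht]
  | tmul m c => simp [alphaMap_tmul]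

/-- Pairing the middle factor of `M ⊗ C ⊗ N` with `a`. -/
noncomputable def pairMiddle (M N : Type u) [AddCommGroup M] [Module R M]
    [AddCommGroup N] [Module R N] (a : A) : M ⊗[R] (C ⊗[R] N) →ₗ[R] M ⊗[R] N :=
  TensorProduct.map LinearMap.id
    ((TensorProduct.lid R N).toLinearMap ∘ₗ TensorProduct.map (β a) LinearMap.id)

lemma pairMiddle_map_coaction_left (ϱ : M →ₗ[R] M ⊗[R] C) (a : A) (x : M ⊗[R] N) :
    pairMiddle β M N a (TensorProduct.assoc R M C N (TensorProduct.map ϱ LinearMap.id x))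
      = TensorProduct.map (inducedAction R β ϱ a) LinearMap.id x := by
  induction x with
  | zero => simp
  | add x y hx hy => simp only [map_add, hx, hy]
  | tmul m n =>
    simp only [TensorProduct.map_tmul, LinearMap.id_apply, inducedAction_apply]
    induction ϱ m with
    | zero => simp
    | add s t hs ht => simp only [map_add, LinearMap.add_apply, TensorProduct.add_tmul, hs, ht]
    | tmul m c => simp [alphaMap_tmul, pairMiddle, TensorProduct.smul_tmul]

lemma pairMiddle_map_coaction_right (ϱ : N →ₗ[R] C ⊗[R] N) (a : A) (x : M ⊗[R] N) :
    pairMiddle β M N a (TensorProduct.map LinearMap.id ϱ x)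
      = TensorProduct.map LinearMap.id (rAct R β ϱ a) x := by
  rw [pairMiddle, ← LinearMap.comp_apply, ← TensorProduct.map_comp]
  rfl

/-- The `α`-condition makes the maps `pairMiddle β M N a` jointly injective. -/
lemma eq_of_pairMiddle_eq (hα : Function.Injective (alphaMap R β (M ⊗[R] N)))
    {s t : M ⊗[R] (C ⊗[R] N)} (h : ∀ a, pairMiddle β M N a s = pairMiddle β M N a t) :
    s = t := by
  let e : M ⊗[R] (C ⊗[R] N) ≃ₗ[R] (M ⊗[R] N) ⊗[R] C :=
    (TensorProduct.congr (LinearEquiv.refl R M) (TensorProduct.comm R C N)).trans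
      (TensorProduct.assoc R M N C).symm
  have key (a : A) : LinearMap.applyₗ a ∘ₗ alphaMap R β (M ⊗[R] N) ∘ₗ e.toLinearMap
      = pairMiddle β M N a := by
    ext m c n
    simp [e, alphaMap_tmul, pairMiddle]
  refine e.injective (hα (LinearMap.ext fun a => ?_))
  have hs := LinearMap.congr_fun (key a) s
  have ht := LinearMap.congr_fun (key a) t
  exact hs.trans ((h a).trans ht.symm)

lemma mem_cotensor_iff {ϱM : M →ₗ[R] M ⊗[R] C} {ϱN : N →ₗ[R] C ⊗[R] N} {x : M ⊗[R] N} :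
    x ∈ cotensor R ϱM ϱN ↔
      TensorProduct.assoc R M C N (TensorProduct.map ϱM LinearMap.id x)
        = TensorProduct.map LinearMap.id ϱN x := by
  simp [cotensor, sub_eq_zero]

/-- On the cotensor product the two induced actions agree. -/
lemma map_inducedAction_eq_map_rAct {ϱM : M →ₗ[R] M ⊗[R] C} {ϱN : N →ₗ[R] C ⊗[R] N}
    {x : M ⊗[R] N} (hx : x ∈ cotensor R ϱM ϱN) (a : A) :
    TensorProduct.map (inducedAction R β ϱM a) LinearMap.id x
      = TensorProduct.map LinearMap.id (rAct R β ϱN a) x := by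
  rw [← pairMiddle_map_coaction_left, mem_cotensor_iff.1 hx, pairMiddle_map_coaction_right]

/-- Under the `α`-condition, agreement of the two induced actions characterises the cotensor
product. -/
lemma mem_cotensor_of_map_inducedAction_eq
    (hα : Function.Injective (alphaMap R β (M ⊗[R] N)))
    {ϱM : M →ₗ[R] M ⊗[R] C} {ϱN : N →ₗ[R] C ⊗[R] N} {x : M ⊗[R] N}
    (h : ∀ a, TensorProduct.map (inducedAction R β ϱM a) LinearMap.id x
      = TensorProduct.map LinearMap.id (rAct R β ϱN a) x) :
    x ∈ cotensor R ϱM ϱN :=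
  mem_cotensor_iff.2 <| eq_of_pairMiddle_eq β hα fun a => by
    rw [pairMiddle_map_coaction_left, pairMiddle_map_coaction_right, h]

/-- Comodule morphisms are linear for the induced actions. -/
lemma inducedAction_comp_comm {ϱM : M →ₗ[R] M ⊗[R] C} {ϱN : N →ₗ[R] N ⊗[R] C}
    {g : M →ₗ[R] N} (hg : ϱN ∘ₗ g = TensorProduct.map g LinearMap.id ∘ₗ ϱM) (a : A) :
    inducedAction R β ϱN a ∘ₗ g = g ∘ₗ inducedAction R β ϱM a := by
  ext m
  have h := LinearMap.congr_fun hg m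
  simp only [LinearMap.comp_apply] at h
  simp only [LinearMap.comp_apply, inducedAction_apply, h, alphaMap_map]

end Pairing

section Algebra

variable [Ring A] [Algebra R A] [Coalgebra R C] {β : A →ₗ[R] C →ₗ[R] R}

lemma inducedAction_one (hone : β 1 = Coalgebra.counit (R := R))
    {ϱ : M →ₗ[R] M ⊗[R] C} (hϱ : IsRightComodule R ϱ) :
    inducedAction R β ϱ 1 = LinearMap.id := by
  ext m
  rw [inducedAction_apply, alphaMap_apply_eq_rid, hone, hϱ.2, LinearMap.id_apply]

lemma rAct_one (hone : β 1 = Coalgebra.counit (R := R))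
    {ϱ : N →ₗ[R] C ⊗[R] N} (hϱ : IsLeftComodule R ϱ) :
    rAct R β ϱ 1 = LinearMap.id := by
  ext n
  rw [rAct, hone]
  exact hϱ.2 n

lemma inducedAction_mul (hmeas : IsMeasuring R β)
    {ϱ : M →ₗ[R] M ⊗[R] C} (hϱ : IsRightComodule R ϱ) (a b : A) :
    inducedAction R β ϱ (a * b) = inducedAction R β ϱ a ∘ₗ inducedAction R β ϱ b := by
  -- evaluate `a` and `b` on the two copies of `C` in the coassociativity identity
  let ev : M ⊗[R] (C ⊗[R] C) →ₗ[R] M := (TensorProduct.rid R M).toLinearMap ∘ₗ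
    TensorProduct.map LinearMap.id (LinearMap.mul' R R ∘ₗ TensorProduct.map (β a) (β b))
  have hleft (t : M ⊗[R] C) :
      ev (TensorProduct.map LinearMap.id (Coalgebra.comul (R := R)) t)
        = alphaMap R β M t (a * b) := by
    rw [alphaMap_apply_eq_rid, hmeas a b]
    induction t with
    | zero => simp
    | add s t hs ht => simp only [map_add, hs, ht]
    | tmul m c => simp [ev]
  have hright (t : M ⊗[R] C) :
      ev (TensorProduct.assoc R M C C (TensorProduct.map ϱ LinearMap.id t))
        = inducedAction R β ϱ a (alphaMap R β M t b) := by
    induction t with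
    | zero => simp
    | add s t hs ht => simp only [map_add, LinearMap.add_apply, hs, ht]
    | tmul m c =>
      simp only [TensorProduct.map_tmul, LinearMap.id_apply, alphaMap_tmul, map_smul,
        inducedAction_apply]
      induction ϱ m with
      | zero => simp
      | add s t hs ht =>
        simp only [map_add, LinearMap.add_apply, TensorProduct.add_tmul, smul_add, hs, ht]
      | tmul m d => simp [alphaMap_tmul, ev, mul_smul, smul_comm (β a d)]
  ext m
  have h := LinearMap.congr_fun hϱ.1 m
  simp only [LinearMap.comp_apply, LinearEquiv.coe_coe] at h
  rw [LinearMap.comp_apply, inducedAction_apply, ← hleft, ← h, hright, ← inducedAction_apply]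

end Algebra

end Helpers

/-- Let `P = (A,C)` be a measuring α-pairing with `A` unital, `M` a right
and `N` a left `C`-comodule, and regard `M ⊗ N` as a left `A^e = A ⊗ Aᵒᵖ`-module via
`(a ⊗ b)·(m ⊗ n) = a·m ⊗ n·b`, and `A` as a left `A^e`-module via `(a ⊗ b)·x = axb`.
Then `γ : M □_C N → Hom_{A^e}(A, M ⊗ N)`, `x ↦ (a ↦ (a·-) ⊗ id)(x)`, is an isomorphism
with inverse `f ↦ f(1)`, natural in `M` and `N`. -/
theorem cotensor_iso_homAe
    {R A C M N : Type u} [CommRing R]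
    [Ring A] [Algebra R A]
    [AddCommGroup C] [Module R C] [Coalgebra R C]
    [AddCommGroup M] [Module R M] [AddCommGroup N] [Module R N]
    (β : A →ₗ[R] C →ₗ[R] R)
    (hmeas : IsMeasuring R β)
    (hone : β 1 = Coalgebra.counit (R := R))
    (hα : ∀ (X : Type u) [AddCommGroup X] [Module R X],
      Function.Injective (alphaMap R β X))
    (ϱM : M →ₗ[R] M ⊗[R] C) (hM : IsRightComodule R ϱM) (hMinj : Function.Injective ϱM)
    (ϱN : N →ₗ[R] C ⊗[R] N) (hN : IsLeftComodule R ϱN) (hNinj : Function.Injective ϱN) :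
    -- `γ` lands in the `A^e`-linear maps `A → M ⊗ N`
    (∀ x ∈ cotensor R ϱM ϱN, ∀ a y b : A,
        TensorProduct.map (inducedAction R β ϱM (a * y * b)) LinearMap.id x
          = TensorProduct.map (inducedAction R β ϱM a) (rAct R β ϱN b)
              (TensorProduct.map (inducedAction R β ϱM y) LinearMap.id x))
    ∧
    -- evaluating `γ x` at `1_A` gives back `x`
    (∀ x ∈ cotensor R ϱM ϱN,
        TensorProduct.map (inducedAction R β ϱM 1) LinearMap.id x = x)
    ∧
    -- `γ` is injective on `M □_C N`
    (∀ x ∈ cotensor R ϱM ϱN, ∀ y ∈ cotensor R ϱM ϱN,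
      (∀ a : A, TensorProduct.map (inducedAction R β ϱM a) LinearMap.id x
          = TensorProduct.map (inducedAction R β ϱM a) LinearMap.id y) → x = y)
    ∧
    -- every `A^e`-linear `f : A → M ⊗ N` is of the form `γ (f 1)`
    (∀ f : A →ₗ[R] M ⊗[R] N,
      (∀ a y b : A,
          f (a * y * b)
            = TensorProduct.map (inducedAction R β ϱM a) (rAct R β ϱN b) (f y)) →
      f 1 ∈ cotensor R ϱM ϱN
      ∧ ∀ a : A, TensorProduct.map (inducedAction R β ϱM a) LinearMap.id (f 1) = f a)
    ∧
    -- naturality of `γ` in `M` and `N`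
    (∀ (M' N' : Type u) [AddCommGroup M'] [Module R M'] [AddCommGroup N'] [Module R N'],
      ∀ (ϱM' : M' →ₗ[R] M' ⊗[R] C) (ϱN' : N' →ₗ[R] C ⊗[R] N'),
        IsRightComodule R ϱM' → IsLeftComodule R ϱN' →
        ∀ (g : M →ₗ[R] M') (h : N →ₗ[R] N'),
          (ϱM' ∘ₗ g = (TensorProduct.map g LinearMap.id) ∘ₗ ϱM) →
          (ϱN' ∘ₗ h = (TensorProduct.map LinearMap.id h) ∘ₗ ϱN) →
          ∀ x ∈ cotensor R ϱM ϱN, ∀ a : A,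
            TensorProduct.map (inducedAction R β ϱM' a) LinearMap.id
                (TensorProduct.map g h x)
              = TensorProduct.map g h
                  (TensorProduct.map (inducedAction R β ϱM a) LinearMap.id x)) := by
  have hAct := fun {x} (hx : x ∈ cotensor R ϱM ϱN) a =>
    map_inducedAction_eq_map_rAct β hx a
  have h1 : ∀ x : M ⊗[R] N,
      TensorProduct.map (inducedAction R β ϱM 1) LinearMap.id x = x := fun x => by
    rw [inducedAction_one hone hM, TensorProduct.map_id, LinearMap.id_apply]
  refine ⟨fun x hx a y b => ?_, fun x _ => h1 x, fun x _ y _ h => ?_, fun f hf => ?_, ?_⟩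
  · have hsplit : TensorProduct.map (inducedAction R β ϱM (a * y * b)) LinearMap.id x
        = TensorProduct.map (inducedAction R β ϱM (a * y)) LinearMap.id
          (TensorProduct.map (inducedAction R β ϱM b) LinearMap.id x) := by
      rw [inducedAction_mul hmeas hM (a * y) b, ← LinearMap.comp_apply,
        ← TensorProduct.map_comp, LinearMap.id_comp]
    rw [hsplit, hAct hx, ← LinearMap.comp_apply, ← LinearMap.comp_apply,
      ← TensorProduct.map_comp, ← TensorProduct.map_comp, inducedAction_mul hmeas hM a y]
    rfl
  · simpa only [h1] using h 1
  · have hl (a : A) :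
        TensorProduct.map (inducedAction R β ϱM a) LinearMap.id (f 1) = f a := by
      have h := hf a 1 1
      rw [mul_one, mul_one, rAct_one hone hN] at h
      exact h.symm
    refine ⟨mem_cotensor_of_map_inducedAction_eq β (hα _) fun a => ?_, hl⟩
    have h := hf 1 1 a
    rw [mul_one, one_mul, inducedAction_one hone hM] at h
    rw [hl, h]
  · intro M' N' _ _ _ _ ϱM' ϱN' _ _ g h hg _ x _ a
    rw [← LinearMap.comp_apply, ← LinearMap.comp_apply, ← TensorProduct.map_comp,
      ← TensorProduct.map_comp, inducedAction_comp_comm β hg, LinearMap.id_comp,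
      LinearMap.comp_id]
end

section
/- Let P=(A,C) and Q=(B,D) be measuring α-pairings with B commutative, and let (ξ,θ): (B,D) → (A,C) be a morphism of measuring pairings (ξ: A→B an algebra morphism, θ: D→C a coalgebra morphism, with ⟨ξ(a), d⟩_Q = ⟨a, θ(d)⟩_P for all a∈A, d∈D). For a left A-module N, regard Hom_A(B,N) (B a left A-module via ξ) as a left B-module via (b'·f)(b) = f(bb'). Then every g in the D-rational part Rat^D(Hom_A(B,N)) satisfies g(B) ⊆ Rat^C(N); consequently Rat^D(Hom_A(B,N)) = Rat^D(Hom_A(B, Rat^C(N))). -/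
open TensorProduct

universe u

section AlphaMap

variable {R A B C D M M' : Type u} [CommRing R]
  [AddCommGroup A] [Module R A] [AddCommGroup B] [Module R B]
  [AddCommGroup C] [Module R C] [AddCommGroup D] [Module R D]
  [AddCommGroup M] [Module R M] [AddCommGroup M'] [Module R M']

theorem alphaMap_tmul_apply (β : A →ₗ[R] C →ₗ[R] R) (m : M) (c : C) (a : A) :
    alphaMap R β M (m ⊗ₜ c) a = β a c • m := by
  simp [alphaMap]

/-- `α_M` is natural in `M`. -/
theorem alphaMap_rTensor_apply (β : A →ₗ[R] C →ₗ[R] R) (f : M →ₗ[R] M') (t : M ⊗[R] C) (a : A) :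
    alphaMap R β M' (f.rTensor C t) a = f (alphaMap R β M t a) := by
  induction t using TensorProduct.induction_on with
  | zero => simp
  | tmul m c => simp [alphaMap_tmul_apply]
  | add x y hx hy => simp [hx, hy]

/-- `α_M` is compatible with morphisms of pairings. -/
theorem alphaMap_lTensor_apply (βP : A →ₗ[R] C →ₗ[R] R) (βQ : B →ₗ[R] D →ₗ[R] R)
    (ξ : A → B) (θ : D →ₗ[R] C) (h : ∀ a d, βQ (ξ a) d = βP a (θ d)) (t : M ⊗[R] D) (a : A) :
    alphaMap R βP M (θ.lTensor M t) a = alphaMap R βQ M t (ξ a) := by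
  induction t using TensorProduct.induction_on with
  | zero => simp
  | tmul m d => simp [alphaMap_tmul_apply, h]
  | add x y hx hy => simp [hx, hy]

theorem mem_ratSubmodule_iff (β : A →ₗ[R] C →ₗ[R] R) (σ : A →ₗ[R] M →ₗ[R] M) (m : M) :
    m ∈ ratSubmodule R β σ ↔ ∃ t : M ⊗[R] C, ∀ a, alphaMap R β M t a = σ a m := by
  simp [ratSubmodule, LinearMap.ext_iff]

/-- Rationality is inherited and reflected by equivariant embeddings. -/
theorem map_mem_ratSubmodule_iff (β : A →ₗ[R] C →ₗ[R] R)
    (hα : ∀ (X : Type u) [AddCommGroup X] [Module R X], Function.Injective (alphaMap R β X))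
    (σ : A →ₗ[R] M →ₗ[R] M) (σ' : A →ₗ[R] M' →ₗ[R] M') (f : M →ₗ[R] M')
    (hf : Function.Injective f) (hfσ : ∀ a m, f (σ a m) = σ' a (f m)) (m : M) :
    f m ∈ ratSubmodule R β σ' ↔ m ∈ ratSubmodule R β σ := by
  simp only [mem_ratSubmodule_iff]
  constructor
  · rintro ⟨t, ht⟩
    have hzero : (LinearMap.range f).mkQ.rTensor C t = 0 := by
      apply hα
      ext a
      rw [alphaMap_rTensor_apply, ht, ← hfσ]
      simp
    have hexact : Function.Exact f (LinearMap.range f).mkQ := by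
      rw [LinearMap.exact_iff, Submodule.ker_mkQ]
    obtain ⟨s, rfl⟩ :=
      (rTensor_exact C hexact (Submodule.mkQ_surjective _) t).1 hzero
    refine ⟨s, fun a => hf ?_⟩
    rw [← alphaMap_rTensor_apply, ht, hfσ]
  · rintro ⟨t, ht⟩
    exact ⟨f.rTensor C t, fun a => by rw [alphaMap_rTensor_apply, ht, hfσ]⟩

end AlphaMap

/-- The map `Hom_A(B, K) → Hom_A(B, N)` induced by an `A`-submodule `K` of `N`. -/
noncomputable def homAInclusion {R A B N : Type u} [CommRing R]
    [Ring A] [Algebra R A] [Ring B] [Algebra R B] [AddCommGroup N] [Module R N]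
    (ξ : A →ₐ[R] B) (σN : A →ₗ[R] N →ₗ[R] N) (K : Submodule R N) (σK : A →ₗ[R] K →ₗ[R] K)
    (hσK : ∀ a k, (σK a k : N) = σN a k) : homA R ξ σK →ₗ[R] homA R ξ σN :=
  (K.subtype.compRight R (M := B)).restrict fun f hf a b => by
    have h : f (ξ a * b) = σK a (f b) := hf a b
    simp [h, hσK]

theorem homAInclusion_apply {R A B N : Type u} [CommRing R]
    [Ring A] [Algebra R A] [Ring B] [Algebra R B] [AddCommGroup N] [Module R N]
    (ξ : A →ₐ[R] B) (σN : A →ₗ[R] N →ₗ[R] N) (K : Submodule R N) (σK : A →ₗ[R] K →ₗ[R] K)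
    (hσK : ∀ a k, (σK a k : N) = σN a k) (f : homA R ξ σK) (b : B) :
    (homAInclusion ξ σN K σK hσK f : B →ₗ[R] N) b = (f : B →ₗ[R] K) b :=
  rfl

/-- Let `P = (A,C)`, `Q = (B,D)` be measuring α-pairings with `B`
commutative and `(ξ,θ) : (B,D) → (A,C)` a morphism of measuring pairings. For a left
`A`-module `N`, every element `g` of the `D`-rational part of `Hom_A(B,N)` (a `B`-module
via `(b'·f)(b) = f(bb')`) satisfies `g(B) ⊆ Rat^C(N)`; consequently
`Rat^D(Hom_A(B,N)) = Rat^D(Hom_A(B, Rat^C(N)))`. -/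
theorem rat_hom_image_rational
    {R A B C D N : Type u} [CommRing R]
    [Ring A] [Algebra R A] [CommRing B] [Algebra R B]
    [AddCommGroup C] [Module R C] [Coalgebra R C]
    [AddCommGroup D] [Module R D] [Coalgebra R D]
    [AddCommGroup N] [Module R N]
    (βP : A →ₗ[R] C →ₗ[R] R) (hmeasP : IsMeasuring R βP)
    (honeP : βP 1 = Coalgebra.counit (R := R))
    (βQ : B →ₗ[R] D →ₗ[R] R) (hmeasQ : IsMeasuring R βQ)
    (honeQ : βQ 1 = Coalgebra.counit (R := R))
    (hαP : ∀ (X : Type u) [AddCommGroup X] [Module R X],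
      Function.Injective (alphaMap R βP X))
    (hαQ : ∀ (X : Type u) [AddCommGroup X] [Module R X],
      Function.Injective (alphaMap R βQ X))
    -- the morphism of measuring pairings `(ξ, θ)`
    (ξ : A →ₐ[R] B) (θ : D →ₗ[R] C)
    (hθcomul : (Coalgebra.comul (R := R)) ∘ₗ θ
        = (TensorProduct.map θ θ) ∘ₗ (Coalgebra.comul (R := R)))
    (hθcounit : (Coalgebra.counit (R := R) (A := C)) ∘ₗ θ = Coalgebra.counit (R := R))
    (hcompat : ∀ (a : A) (d : D), βQ (ξ a) d = βP a (θ d))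
    -- `N` a (unital) left `A`-module
    (σN : A →ₗ[R] N →ₗ[R] N)
    (hσN : ∀ a a' : A, σN (a * a') = (σN a) ∘ₗ (σN a'))
    (hσNone : σN 1 = LinearMap.id)
    -- the `B`-module structure on `Hom_A(B,N)`: `(b' · f)(b) = f (b * b')`
    (σH : B →ₗ[R] ↥(homA R ξ σN) →ₗ[R] ↥(homA R ξ σN))
    (hσH : ∀ (b' : B) (f : ↥(homA R ξ σN)) (b : B),
      ((σH b' f : ↥(homA R ξ σN)) : B →ₗ[R] N) b = ((f : B →ₗ[R] N)) (b * b'))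
    -- the induced `A`-module structure on `Rat^C(N)`
    (σK : A →ₗ[R] ↥(ratSubmodule R βP σN) →ₗ[R] ↥(ratSubmodule R βP σN))
    (hσK : ∀ (a : A) (k : ↥(ratSubmodule R βP σN)),
      ((σK a k : ↥(ratSubmodule R βP σN)) : N) = σN a (k : N))
    -- the `B`-module structure on `Hom_A(B, Rat^C(N))`
    (σH₂ : B →ₗ[R] ↥(homA R ξ σK) →ₗ[R] ↥(homA R ξ σK))
    (hσH₂ : ∀ (b' : B) (f : ↥(homA R ξ σK)) (b : B),
      ((σH₂ b' f : ↥(homA R ξ σK)) : B →ₗ[R] ↥(ratSubmodule R βP σN)) b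
        = ((f : B →ₗ[R] ↥(ratSubmodule R βP σN))) (b * b')) :
    -- every `D`-rational `g` satisfies `g(B) ⊆ Rat^C(N)` …
    (∀ g : ↥(homA R ξ σN), g ∈ ratSubmodule R βQ σH →
      ∀ b : B, ((g : B →ₗ[R] N)) b ∈ ratSubmodule R βP σN)
    ∧
    -- … consequently `Rat^D(Hom_A(B,N)) = Rat^D(Hom_A(B, Rat^C(N)))`
    (∀ g : ↥(homA R ξ σN),
      g ∈ ratSubmodule R βQ σH
      ↔ ∃ g₂ : ↥(homA R ξ σK), g₂ ∈ ratSubmodule R βQ σH₂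
          ∧ ∀ b : B,
              ((((g₂ : B →ₗ[R] ↥(ratSubmodule R βP σN))) b : N)
                = ((g : B →ₗ[R] N)) b)) := by
  have image_rational : ∀ g : ↥(homA R ξ σN), g ∈ ratSubmodule R βQ σH →
      ∀ b : B, (g : B →ₗ[R] N) b ∈ ratSubmodule R βP σN := by
    intro g hg b
    obtain ⟨t, ht⟩ := (mem_ratSubmodule_iff _ _ _).1 hg
    let ev : ↥(homA R ξ σN) →ₗ[R] N := LinearMap.applyₗ b ∘ₗ (homA R ξ σN).subtype
    refine (mem_ratSubmodule_iff _ _ _).2 ⟨θ.lTensor N (ev.rTensor D t), fun a => ?_⟩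
    rw [alphaMap_lTensor_apply βP βQ ξ θ hcompat, alphaMap_rTensor_apply, ht]
    change (σH (ξ a) g : B →ₗ[R] N) b = _
    rw [hσH, mul_comm]
    exact g.2 a b
  let ι := homAInclusion ξ σN (ratSubmodule R βP σN) σK hσK
  have ι_injective : Function.Injective ι := fun f f' h => by
    ext b
    exact congrArg (fun k : ↥(homA R ξ σN) => (k : B →ₗ[R] N) b) h
  have ι_equivariant : ∀ b f, ι (σH₂ b f) = σH b (ι f) := fun b f => by
    ext b'
    rw [hσH, homAInclusion_apply, hσH₂, homAInclusion_apply]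
  have ι_mem_iff := map_mem_ratSubmodule_iff (M := ↥(homA R ξ σK)) (M' := ↥(homA R ξ σN))
    βQ hαQ σH₂ σH ι ι_injective ι_equivariant
  refine ⟨image_rational, fun g => ⟨fun hg => ?_, ?_⟩⟩
  · let g₂ : ↥(homA R ξ σK) :=
      ⟨(g : B →ₗ[R] N).codRestrict _ (image_rational g hg), fun a b => by
        ext
        rw [hσK]
        exact g.2 a b⟩
    exact ⟨g₂, (ι_mem_iff g₂).1 hg, fun _ => rfl⟩
  · rintro ⟨g₂, hg₂, h⟩
    have hg : ι g₂ = g := by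
      ext b
      exact h b
    exact hg ▸ (ι_mem_iff g₂).2 hg₂
end
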